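/- Let q be squarefree, let r | q, let ψ be a Dirichlet character mod r, let h : ℤ → ℂ have period q with h(n) = ∏_{p | q} h_p(n) where each h_p has period p, and suppose for every prime p | q that |Σ_{a mod p} ψ_p(a)h_p(a)| ≤ K√p for the local factors. If D is a divisor of q with r | D, then the pseudo-Gauss sum G_h(D;ψ) := Σ_{a=1}^{D} ψ(a) h(aq/D) factors by the Chinese Remainder Theorem as G_h(D;ψ) = h_{q/D}(0)·ψ̄(q/D)·∏_{p | r}(Σ_{a mod p} ψ_p(a)h_p(a))·∏_{p | D/r}(Σ_{b mod p} h_p(b)), where ψ = ∏_{p|r} ψ_p and h_m := ∏_{p|m} h_p. -/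

import Mathlib

open Finset

lemma crt_two (m n : ℕ) (hm : 0 < m) (hn : 0 < n) (hmn : Nat.Coprime m n) (f g : ℕ → ℂ)
    (hf : Function.Periodic f m) (hg : Function.Periodic g n) :
    ∑ a ∈ range (m * n), f a * g a = (∑ a ∈ range m, f a) * ∑ a ∈ range n, g a := by
  rw [Finset.sum_mul_sum, ← Finset.sum_product']
  have hinj : Set.InjOn (fun a : ℕ => (a % m, a % n)) (range (m * n) : Finset ℕ) := by
    intro a ha b hb hab
    simp only [Prod.mk.injEq] at hab
    simp only [coe_range, Set.mem_Iio] at ha hb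
    have := (Nat.modEq_and_modEq_iff_modEq_mul hmn).1 ⟨hab.1, hab.2⟩
    exact Nat.ModEq.eq_of_lt_of_lt this ha hb
  have hmaps : Set.MapsTo (fun a : ℕ => (a % m, a % n)) (range (m * n) : Finset ℕ)
      (range m ×ˢ range n : Finset (ℕ × ℕ)) := by
    intro a _
    simp [Nat.mod_lt _ hm, Nat.mod_lt _ hn]
  refine Finset.sum_nbij (fun a : ℕ => (a % m, a % n)) hmaps hinj ?_ ?_
  · exact Finset.surjOn_of_injOn_of_card_le _ hmaps hinj (by simp)
  · intro a _
    simp only [hf.map_mod_nat, hg.map_mod_nat]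

lemma scale_sum (p m : ℕ) (hp : 0 < p) (hmp : Nat.Coprime p m) (g : ℕ → ℂ)
    (hg : Function.Periodic g p) :
    ∑ a ∈ range p, g (a * m) = ∑ a ∈ range p, g a := by
  have hinj : Set.InjOn (fun a : ℕ => a * m % p) (range p : Finset ℕ) := by
    intro a ha b hb hab
    simp only [coe_range, Set.mem_Iio] at ha hb
    exact Nat.ModEq.eq_of_lt_of_lt (Nat.ModEq.cancel_right_of_coprime hmp hab) ha hb
  have hmaps : Set.MapsTo (fun a : ℕ => a * m % p) (range p : Finset ℕ) (range p : Finset ℕ) := by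
    intro a _
    simp [Nat.mod_lt _ hp]
  refine Finset.sum_nbij (fun a : ℕ => a * m % p) hmaps hinj ?_ ?_
  · exact Finset.surjOn_of_injOn_of_card_le _ hmaps hinj (by simp)
  · intro a _
    simp only [hg.map_mod_nat]

lemma periodic_prod (S : Finset ℕ) (F : ℕ → ℕ → ℂ)
    (hF : ∀ p ∈ S, Function.Periodic (F p) p) :
    Function.Periodic (fun a => ∏ p ∈ S, F p a) (∏ p ∈ S, p) := by
  intro a
  refine Finset.prod_congr rfl fun p hp => ?_
  obtain ⟨k, hk⟩ := Finset.dvd_prod_of_mem (fun p : ℕ => p) hp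
  rw [hk, mul_comm]
  exact (hF p hp).nat_mul k a

lemma crt_many (S : Finset ℕ) (hS : ∀ p ∈ S, p.Prime) (F : ℕ → ℕ → ℂ)
    (hF : ∀ p ∈ S, Function.Periodic (F p) p) :
    ∑ a ∈ range (∏ p ∈ S, p), ∏ p ∈ S, F p a = ∏ p ∈ S, ∑ a ∈ range p, F p a := by
  induction S using Finset.induction_on with
  | empty => simp
  | insert p S hp ih =>
    have h1 := fun x hx => hS x (mem_insert_of_mem hx)
    have h2 := fun x hx => hF x (mem_insert_of_mem hx)
    have hpp := hS p (mem_insert_self _ _)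
    simp only [Finset.prod_insert hp]
    rw [crt_two _ _ hpp.pos (Finset.prod_pos fun x hx => (h1 x hx).pos) _ (F p)
      (fun a => ∏ x ∈ S, F x a) (hF p (mem_insert_self _ _)) (periodic_prod S F h2), ih h1 h2]
    refine Nat.Coprime.prod_right fun x hx => ?_
    exact (Nat.coprime_primes hpp (h1 x hx)).2 (fun e => hp (e ▸ hx))

theorem stmt_10 (q r D : ℕ) (hq : Squarefree q) (hr : r ∣ q) (hD : D ∣ q) (hrD : r ∣ D)
    (H : ℕ → ℤ → ℂ)
    (hHper : ∀ p ∈ q.primeFactors, ∀ n : ℤ, H p (n + p) = H p n)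
    (h : ℤ → ℂ) (hh : ∀ n : ℤ, h n = ∏ p ∈ q.primeFactors, H p n)
    (Ψ : (p : ℕ) → DirichletCharacter ℂ p)
    (ψ : ℤ → ℂ) (hψ : ∀ n : ℤ, ψ n = ∏ p ∈ r.primeFactors, Ψ p ((n : ZMod p)))
    (K : ℝ)
    (hK : ∀ p ∈ r.primeFactors,
      ‖∑ a ∈ Finset.range p, Ψ p ((a : ZMod p)) * H p (a : ℤ)‖ ≤ K * Real.sqrt p) :
    ∑ a ∈ Finset.Icc 1 D, ψ (a : ℤ) * h ((a : ℤ) * ((q / D : ℕ) : ℤ)) =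
      (∏ p ∈ (q / D).primeFactors, H p 0) * (starRingEnd ℂ) (ψ ((q / D : ℕ) : ℤ)) *
        (∏ p ∈ r.primeFactors, ∑ a ∈ Finset.range p, Ψ p ((a : ZMod p)) * H p (a : ℤ)) *
        (∏ p ∈ (D / r).primeFactors, ∑ b ∈ Finset.range p, H p (b : ℤ)) := by
  clear hK
  obtain ⟨m, rfl⟩ := hD
  obtain ⟨s, rfl⟩ := hrD
  have hq0 := hq.ne_zero
  have hm0 : m ≠ 0 := right_ne_zero_of_mul hq0
  have hD0 : r * s ≠ 0 := left_ne_zero_of_mul hq0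
  have hr0 : r ≠ 0 := left_ne_zero_of_mul hD0
  have hs0 : s ≠ 0 := right_ne_zero_of_mul hD0
  have cDm : Nat.Coprime (r * s) m := Nat.coprime_of_squarefree_mul hq
  have hDsq : Squarefree (r * s) := hq.of_mul_left
  have crs : Nat.Coprime r s := Nat.coprime_of_squarefree_mul hDsq
  rw [Nat.mul_div_cancel_left _ (Nat.pos_of_ne_zero hD0),
    Nat.mul_div_cancel_left _ (Nat.pos_of_ne_zero hr0)]
  have hpfq : (r * s * m).primeFactors = (r * s).primeFactors ∪ m.primeFactors :=
    Nat.primeFactors_mul hD0 hm0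
  have hpfD : (r * s).primeFactors = r.primeFactors ∪ s.primeFactors :=
    Nat.primeFactors_mul hr0 hs0
  have dDm : Disjoint (r * s).primeFactors m.primeFactors := cDm.disjoint_primeFactors
  have drs : Disjoint r.primeFactors s.primeFactors := crs.disjoint_primeFactors
  have hper : ∀ p ∈ (r * s * m).primeFactors, Function.Periodic (H p) (p : ℤ) := hHper
  let F : ℕ → ℕ → ℂ := fun p a =>
    (if p ∈ r.primeFactors then Ψ p (a : ZMod p) else 1) * H p ((a : ℤ) * (m : ℤ))
  have hFper : ∀ p ∈ (r * s).primeFactors, Function.Periodic (F p) p := by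
    intro p hp a
    have h1 := hper p (by rw [hpfq]; exact mem_union_left _ hp)
    have h2 := h1.int_mul (m : ℤ) ((a : ℤ) * m)
    simp only [F]
    have e : (((a + p : ℕ) : ℤ) * (m : ℤ)) = (a : ℤ) * m + (m : ℤ) * (p : ℤ) := by
      push_cast; ring
    rw [e]
    simp only [Int.cast_natCast, Int.cast_id] at h2
    rw [h2]
    simp
  have hterm : ∀ a : ℕ, ψ (a : ℤ) * h ((a : ℤ) * (m : ℤ)) =
      (∏ p ∈ m.primeFactors, H p 0) * ∏ p ∈ (r * s).primeFactors, F p a := by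
    intro a
    rw [hψ, hh, hpfq, Finset.prod_union dDm]
    simp only [F]
    rw [Finset.prod_mul_distrib]
    have e1 : ∏ p ∈ (r * s).primeFactors, (if p ∈ r.primeFactors then Ψ p (a : ZMod p) else 1)
        = ∏ p ∈ r.primeFactors, Ψ p (((a : ℤ) : ZMod p)) := by
      rw [Finset.prod_ite_mem, hpfD, Finset.inter_eq_right.2 Finset.subset_union_left]
      simp
    have e2 : ∏ p ∈ m.primeFactors, H p ((a : ℤ) * (m : ℤ)) = ∏ p ∈ m.primeFactors, H p 0 := by
      refine Finset.prod_congr rfl fun p hp => ?_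
      obtain ⟨k, hk⟩ := Nat.dvd_of_mem_primeFactors hp
      have h1 := hper p (by rw [hpfq]; exact mem_union_right _ hp)
      have h2 := h1.int_mul ((a : ℤ) * k) 0
      simp only [Int.cast_id, zero_add] at h2
      rw [← h2, hk]
      congr 1
      push_cast; ring
    rw [e1, e2]; ring
  have hprod : ∏ p ∈ (r * s).primeFactors, p = r * s := Nat.prod_primeFactors_of_squarefree hDsq
  have hIcc : ∀ g : ℕ → ℂ, Function.Periodic g (r * s) →
      ∑ a ∈ Finset.Icc 1 (r * s), g a = ∑ a ∈ range (r * s), g a := by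
    intro g hg
    have e1 := Finset.sum_range_succ g (r * s)
    have e2 := Finset.sum_range_eq_add_Ico g (Nat.succ_pos (r * s))
    have e3 : g (r * s) = g 0 := by simpa using hg 0
    have e4 : Finset.Ico 1 (Nat.succ (r * s)) = Finset.Icc 1 (r * s) := by
      ext x; simp
    rw [e4] at e2
    rw [Nat.succ_eq_add_one, e1, e3] at e2
    linear_combination -e2
  simp only [hterm]
  rw [← Finset.mul_sum]
  have hP := periodic_prod _ F hFper
  rw [hprod] at hP
  rw [hIcc _ hP]
  have hC := crt_many (r * s).primeFactors (fun p hp => Nat.prime_of_mem_primeFactors hp) F hFper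
  rw [hprod] at hC
  rw [hC, hpfD, Finset.prod_union drs, hψ, map_prod]
  have hcop : ∀ p ∈ (r * s).primeFactors, Nat.Coprime p m := fun p hp =>
    Nat.Coprime.coprime_dvd_left (Nat.dvd_of_mem_primeFactors hp) cDm
  have hnat : ∀ p ∈ (r * s).primeFactors, Function.Periodic (fun a : ℕ => H p (a : ℤ)) p := by
    intro p hp a
    simp only [Nat.cast_add]
    exact hper p (by rw [hpfq]; exact mem_union_left _ hp) a
  have hs : ∀ p ∈ s.primeFactors, ∑ a ∈ range p, F p a = ∑ b ∈ range p, H p (b : ℤ) := by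
    intro p hp
    have hpD : p ∈ (r * s).primeFactors := by rw [hpfD]; exact mem_union_right _ hp
    have := scale_sum p m (Nat.prime_of_mem_primeFactors hp).pos (hcop p hpD) _ (hnat p hpD)
    rw [← this]
    have hn : p ∉ r.primeFactors := fun hc => Finset.disjoint_left.1 drs hc hp
    simp only [F, if_neg hn, one_mul, Nat.cast_mul]
  have hrr : ∀ p ∈ r.primeFactors, ∑ a ∈ range p, F p a =
      (starRingEnd ℂ) (Ψ p (((m : ℤ) : ZMod p))) *
        ∑ a ∈ range p, Ψ p (a : ZMod p) * H p (a : ℤ) := by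
    intro p hp
    have hpD : p ∈ (r * s).primeFactors := by rw [hpfD]; exact mem_union_left _ hp
    have hg : Function.Periodic (fun a : ℕ => Ψ p (a : ZMod p) * H p (a : ℤ)) p := by
      intro a
      have := hnat p hpD a
      simp only at this
      simp only [this]
      simp
    have := scale_sum p m (Nat.prime_of_mem_primeFactors hp).pos (hcop p hpD) _ hg
    rw [← this, Finset.mul_sum]
    have hu : ‖Ψ p (m : ZMod p)‖ = 1 := by
      have := (Ψ p).unit_norm_eq_one (ZMod.unitOfCoprime m (hcop p hpD).symm)
      simpa using this
    have hc : (starRingEnd ℂ) (Ψ p (m : ZMod p)) * Ψ p (m : ZMod p) = 1 := by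
      rw [Complex.conj_mul', hu]; simp
    refine Finset.sum_congr rfl fun a _ => ?_
    simp only [F, if_pos hp, Nat.cast_mul, map_mul, Int.cast_natCast]
    linear_combination (-(Ψ p (a : ZMod p) * H p ((a : ℤ) * (m : ℤ)))) * hc
  rw [Finset.prod_congr rfl hs, Finset.prod_congr rfl hrr, Finset.prod_mul_distrib]
  ring
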